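/- Let θ : ℝ × ℝ^d → ℝ^d be a continuously differentiable, compactly supported time-dependent velocity field, let T be its flow, and assume T is twice continuously differentiable jointly in (t, X). Let Ω ⊆ ℝ^d be a bounded measurable set. Then the map t ↦ λ^d(T_t(Ω)), where λ^d is d-dimensional Lebesgue measure, is differentiable at t = 0 with derivative ∫_Ω (div θ)(0, x) dx, where (div θ)(0, x) is the trace of the spatial Fréchet derivative of θ(0, ·) at x. -/

import Mathlib

open MeasureTheory

/-- `Euc d` is the Euclidean space `ℝ^d`. -/
abbrev Euc (d : ℕ) := EuclideanSpace ℝ (Fin d)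

open Topology Filter

section Determinant

variable {E : Type*} [NormedAddCommGroup E] [NormedSpace ℝ E] [FiniteDimensional ℝ E]

/-- The determinant is a smooth function on the endomorphisms of a finite-dimensional space. -/
theorem ContinuousLinearMap.contDiff_det {n : WithTop ℕ∞} :
    ContDiff ℝ n (fun A : E →L[ℝ] E => A.det) := by
  classical
  let b := Module.finBasis ℝ E
  have hdet : (fun A : E →L[ℝ] E => A.det) =
      fun A : E →L[ℝ] E => (LinearMap.toMatrix b b A.toLinearMap).det := by
    ext A
    exact (LinearMap.det_toMatrix b A.toLinearMap).symm
  rw [hdet]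
  simp only [Matrix.det_apply]
  refine ContDiff.sum fun σ _ => ContDiff.const_smul _ (contDiff_prod fun i _ => ?_)
  let entry : (E →L[ℝ] E) →ₗ[ℝ] ℝ :=
    LinearMap.comp (Matrix.entryLinearMap ℝ ℝ (σ i) i)
      ((LinearMap.toMatrix b b).toLinearMap ∘ₗ ContinuousLinearMap.coeLM ℝ)
  exact entry.toContinuousLinearMap.contDiff

/-- The derivative of the determinant at the identity is the trace. -/
theorem ContinuousLinearMap.fderiv_det_one_apply (H : E →L[ℝ] E) :
    fderiv ℝ (fun A : E →L[ℝ] E => A.det) 1 H = LinearMap.trace ℝ E H.toLinearMap := by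
  classical
  let b := Module.finBasis ℝ E
  have hcurve : HasDerivAt (fun r : ℝ => (1 : E →L[ℝ] E) + r • H) H 0 := by
    simpa using ((hasDerivAt_id (0 : ℝ)).smul_const H).const_add 1
  have hdet : HasFDerivAt (fun A : E →L[ℝ] E => A.det)
      (fderiv ℝ (fun A : E →L[ℝ] E => A.det) 1) (1 + (0 : ℝ) • H) := by
    simpa using (contDiff_det (n := 1)).differentiable one_ne_zero
      (1 : E →L[ℝ] E) |>.hasFDerivAt
  have hcomp := hdet.comp_hasDerivAt 0 hcurve
  set M := LinearMap.toMatrix b b H.toLinearMap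
  obtain ⟨p, hp⟩ : ∃ p : Polynomial ℝ, ∀ r : ℝ,
      ((1 : E →L[ℝ] E) + r • H).det = 1 + M.trace * r + p.eval r * r ^ 2 := by
    refine ⟨((1 + (Polynomial.X : Polynomial ℝ) • M.map Polynomial.C).det).divX.divX,
      fun r => ?_⟩
    rw [← Matrix.det_one_add_smul, ContinuousLinearMap.det, ← LinearMap.det_toMatrix b]
    simp [M, LinearMap.toMatrix_one]
  have hpoly : HasDerivAt (fun r : ℝ => 1 + M.trace * r + p.eval r * r ^ 2) M.trace 0 := by
    refine ((((hasDerivAt_id (0 : ℝ)).const_mul M.trace).const_add 1).add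
      ((p.hasDerivAt 0).mul (hasDerivAt_pow 2 (0 : ℝ)))).congr_deriv ?_
    simp
  rw [LinearMap.trace_eq_matrix_trace ℝ b]
  exact hcomp.unique (hpoly.congr_of_eventuallyEq (Eventually.of_forall hp))

end Determinant

/-- Differentiation under the integral sign over a bounded set, for a `C¹` integrand. -/
theorem hasDerivAt_setIntegral_of_contDiff {E : Type*} [NormedAddCommGroup E] [NormedSpace ℝ E]
    [ProperSpace E] [MeasurableSpace E] [BorelSpace E] {μ : Measure E}
    [IsFiniteMeasureOnCompacts μ] {J : ℝ × E → ℝ} (hJ : ContDiff ℝ 1 J) {Ω : Set E}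
    (hΩb : Bornology.IsBounded Ω) (hΩm : MeasurableSet Ω) (t₀ : ℝ) :
    HasDerivAt (fun t => ∫ x in Ω, J (t, x) ∂μ)
      (∫ x in Ω, fderiv ℝ J (t₀, x) (1, 0) ∂μ) t₀ := by
  have hK : IsCompact (closure Ω) := hΩb.isCompact_closure
  have hint : ∀ {f : E → ℝ}, Continuous f → IntegrableOn f Ω μ := fun hf =>
    (hf.continuousOn.integrableOn_compact hK).mono_set subset_closure
  have hJ' : Continuous fun p : ℝ × E => fderiv ℝ J p (1, 0) :=
    (hJ.continuous_fderiv one_ne_zero).clm_apply continuous_const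
  obtain ⟨C, hC⟩ := ((isCompact_closedBall t₀ 1).prod hK).exists_bound_of_continuousOn
    hJ'.continuousOn
  refine (hasDerivAt_integral_of_dominated_loc_of_deriv_le (bound := fun _ => C)
    (F := fun t x => J (t, x)) (F' := fun t x => fderiv ℝ J (t, x) (1, 0))
    (Metric.closedBall_mem_nhds t₀ one_pos) ?_ ?_ ?_ ?_ ?_ ?_).2
  · exact Eventually.of_forall fun t =>
      (hint (hJ.continuous.comp (by fun_prop : Continuous fun x : E => (t, x)))).1
  · exact hint (hJ.continuous.comp (by fun_prop : Continuous fun x : E => (t₀, x)))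
  · exact (hint (hJ'.comp (by fun_prop : Continuous fun x : E => (t₀, x)))).1
  · filter_upwards [ae_restrict_mem hΩm] with x hx t ht
    exact hC (t, x) ⟨ht, subset_closure hx⟩
  · exact hint continuous_const
  · refine Eventually.of_forall fun x t _ => ?_
    exact ((hJ.differentiable one_ne_zero (t, x)).hasFDerivAt).comp_hasDerivAt t
      ((hasDerivAt_id t).prodMk (hasDerivAt_const t x))

/-- The time-`t` map of the flow of a Lipschitz velocity field is injective. -/
theorem injective_of_flow {E : Type*} [NormedAddCommGroup E] [NormedSpace ℝ E]
    {θ : ℝ × E → E} {C : NNReal} (hθ : LipschitzWith C θ) {T : ℝ → E → E}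
    (hT0 : ∀ X, T 0 X = X) (hT : ∀ t X, HasDerivAt (fun s => T s X) (θ (t, T t X)) t) (t : ℝ) :
    Function.Injective (T t) := by
  intro X Y hXY
  have h := ODE_solution_unique_univ (v := fun t x => θ (t, x)) (s := fun _ => Set.univ)
    (t₀ := t) (K := C * 1) (fun t => (hθ.comp (LipschitzWith.prodMk_left t)).lipschitzOnWith)
    (fun t => ⟨hT t X, Set.mem_univ _⟩) (fun t => ⟨hT t Y, Set.mem_univ _⟩) hXY
  simpa [hT0] using congrFun h 0

/-- The spatial derivative of a `C²` flow, differentiated in time at `t = 0`, is the spatial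
derivative of the velocity field. -/
theorem fderiv_fderiv_flow {E : Type*} [NormedAddCommGroup E] [NormedSpace ℝ E]
    {θ : ℝ × E → E} {T : ℝ → E → E} (hT0 : ∀ X, T 0 X = X)
    (hT : ∀ t X, HasDerivAt (fun s => T s X) (θ (t, T t X)) t)
    (hT2 : ContDiff ℝ 2 (fun p : ℝ × E => T p.1 p.2)) (x v : E) :
    fderiv ℝ (fderiv ℝ fun p : ℝ × E => T p.1 p.2) (0, x) (1, 0) (0, v) =
      fderiv ℝ (fun y => θ (0, y)) x v := by
  set G := fun p : ℝ × E => T p.1 p.2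
  have hsymm : IsSymmSndFDerivAt ℝ G (0, x) := hT2.contDiffAt.isSymmSndFDerivAt (by simp)
  rw [hsymm]
  have htime : ∀ y, fderiv ℝ G (0, y) (1, 0) = θ (0, y) := fun y => by
    have h := (hT2.differentiable two_ne_zero (0, y)).hasFDerivAt.comp_hasDerivAt (0 : ℝ)
      ((hasDerivAt_id (0 : ℝ)).prodMk (hasDerivAt_const (0 : ℝ) y))
    simpa [hT0] using h.unique (hT 0 y)
  have hG' : ContDiff ℝ 1 (fderiv ℝ G) := hT2.fderiv_right (by norm_num)
  have h := (((hG'.differentiable one_ne_zero (0, x)).hasFDerivAt.comp x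
    (hasFDerivAt_prodMk_right (0 : ℝ) x)).clm_apply (hasFDerivAt_const ((1 : ℝ), (0 : E)) x))
  have h' : HasFDerivAt (fun y => θ (0, y)) _ x := h.congr_of_eventuallyEq
    (Eventually.of_forall fun y => (htime y).symm)
  rw [h'.fderiv]
  simp

/-- Eulerian derivative of the volume functional: `t ↦ λ^d(T_t(Ω))` is
differentiable at `t = 0` with derivative `∫_Ω (div θ)(0, x) dx`. -/
theorem volume_eulerian_derivative {d : ℕ}
    (θ : ℝ × Euc d → Euc d)
    (hθ : ContDiff ℝ 1 θ) (hθc : HasCompactSupport θ)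
    (T : ℝ → Euc d → Euc d)
    (hT0 : ∀ X, T 0 X = X)
    (hTflow : ∀ t X, HasDerivAt (fun s => T s X) (θ (t, T t X)) t)
    (hT2 : ContDiff ℝ 2 (fun p : ℝ × Euc d => T p.1 p.2))
    (Ω : Set (Euc d)) (hΩb : Bornology.IsBounded Ω) (hΩm : MeasurableSet Ω) :
    HasDerivAt (fun t => (volume (T t '' Ω)).toReal)
      (∫ x in Ω, LinearMap.trace ℝ (Euc d) ((fderiv ℝ (fun y => θ (0, y)) x).toLinearMap))
      0 := by
  obtain ⟨C, hC⟩ := hθ.lipschitzWith_of_hasCompactSupport hθc one_ne_zero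
  set G := fun p : ℝ × Euc d => T p.1 p.2
  let restr := (ContinuousLinearMap.compL ℝ (Euc d) (ℝ × Euc d) (Euc d)).flip
    (ContinuousLinearMap.inr ℝ ℝ (Euc d))
  let D : ℝ × Euc d → Euc d →L[ℝ] Euc d := fun p => restr (fderiv ℝ G p)
  have hG' : ContDiff ℝ 1 (fderiv ℝ G) := hT2.fderiv_right (by norm_num)
  have hD : ContDiff ℝ 1 D := restr.contDiff.comp hG'
  have hDT : ∀ t x, HasFDerivAt (T t) (D (t, x)) x := fun t x =>
    (hT2.differentiable two_ne_zero (t, x)).hasFDerivAt.comp x (hasFDerivAt_prodMk_right t x)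
  have hD0 : ∀ x, D (0, x) = 1 := fun x =>
    (hDT 0 x).unique ((hasFDerivAt_id x).congr_of_eventuallyEq (Eventually.of_forall hT0))
  have hJ : ContDiff ℝ 1 fun p => (D p).det := ContinuousLinearMap.contDiff_det.comp hD
  have hJpos : ∀ᶠ t in 𝓝 (0 : ℝ), ∀ x ∈ closure Ω, 0 < (D (t, x)).det := by
    refine hΩb.isCompact_closure.eventually_forall_of_forall_eventually fun x _ => ?_
    refine (hJ.continuous.continuousAt (x := ((0 : ℝ), x))).eventually (lt_mem_nhds ?_)
    simp [hD0, ContinuousLinearMap.det]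
  have hvol : (fun t => (volume (T t '' Ω)).toReal) =ᶠ[𝓝 0]
      fun t => ∫ x in Ω, (D (t, x)).det := by
    filter_upwards [hJpos] with t ht
    have h := integral_image_eq_integral_abs_det_fderiv_smul volume hΩm
      (fun x _ => (hDT t x).hasFDerivWithinAt)
      (injective_of_flow hC hT0 hTflow t).injOn (fun _ => (1 : ℝ))
    rw [setIntegral_const, smul_eq_mul, mul_one] at h
    refine h.trans (setIntegral_congr_fun hΩm fun x hx => ?_)
    simp [abs_of_pos (ht x (subset_closure hx))]
  refine HasDerivAt.congr_of_eventuallyEq ?_ hvol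
  refine (hasDerivAt_setIntegral_of_contDiff (μ := volume) hJ hΩb hΩm 0).congr_deriv ?_
  refine integral_congr_ae (Eventually.of_forall fun x => ?_)
  have hdet : HasFDerivAt (fun A : Euc d →L[ℝ] Euc d => A.det)
      (fderiv ℝ (fun A : Euc d →L[ℝ] Euc d => A.det) 1) (D (0, x)) := by
    rw [hD0]
    exact ((ContinuousLinearMap.contDiff_det (n := 1)).differentiable one_ne_zero _).hasFDerivAt
  have hD' : HasFDerivAt D _ (0, x) := restr.hasFDerivAt.comp ((0 : ℝ), x)
    (hG'.differentiable one_ne_zero (0, x)).hasFDerivAt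
  have hcomp : HasFDerivAt (fun p => (D p).det) _ (0, x) := hdet.comp ((0 : ℝ), x) hD'
  simp only [hcomp.fderiv, ContinuousLinearMap.comp_apply]
  rw [ContinuousLinearMap.fderiv_det_one_apply]
  congr 2
  ext1 v
  exact fderiv_fderiv_flow hT0 hTflow hT2 x v
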